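/- Let F₁ and F₂ be free factor systems of the free group Fₙ, and define F₁ ∧ F₂ to be the collection of conjugacy classes of nontrivial subgroups of the form F^i ∩ c F^j c⁻¹ with [[F^i]] ∈ F₁, [[F^j]] ∈ F₂, c ∈ Fₙ. If F₁ ∧ F₂ ≠ F₁ then the complexity of F₁ ∧ F₂ is strictly smaller than the complexity of F₁, where the complexity of a free factor system {[[F¹]],…,[[Fᵏ]]} is the non-increasing sequence of the ranks of the Fⁱ ordered lexicographically (with the empty system having complexity 0). -/

import Mathlib

/-- The conjugate `c A c⁻¹` of a subgroup `A`. -/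
def conjSub {G : Type*} [Group G] (c : G) (A : Subgroup G) : Subgroup G :=
  A.map (MulAut.conj c).toMonoidHom

/-- `K` is the internal free product of the family of subgroups `H i`. -/
def IsFreeProductDecomp {G : Type*} [Group G] {ι : Type*}
    (K : Subgroup G) (H : ι → Subgroup G) : Prop :=
  (∀ i, H i ≤ K) ∧
    Function.Injective (Monoid.CoprodI.lift fun i => (H i).subtype) ∧
    (⨆ i, H i) = K

/-- `F` represents a free factor system of the free group: the `F i` are nontrivial and
`F 0 ∗ ⋯ ∗ F (k-1)` is a free factor (there is a complementary `B` giving a free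
product decomposition of the whole group). -/
def IsFreeFactorSystem {n k : ℕ} (F : Fin k → Subgroup (FreeGroup (Fin n))) : Prop :=
  (∀ i, F i ≠ ⊥) ∧
    ∃ B : Subgroup (FreeGroup (Fin n)),
      IsFreeProductDecomp (⊤ : Subgroup (FreeGroup (Fin n)))
        (fun o : Option (Fin k) => o.elim B F)

/-- The set of subgroups in the conjugacy classes `[[F i]]` of a system. -/
def classes {n k : ℕ} (F : Fin k → Subgroup (FreeGroup (Fin n))) :
    Set (Subgroup (FreeGroup (Fin n))) :=
  {K | ∃ i c, K = conjSub c (F i)}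

/-- The meet `𝓕₁ ∧ 𝓕₂`: all nontrivial subgroups of the form `F^i ∩ c F^j c⁻¹`,
described (closing under conjugacy) as nontrivial intersections of members of the two
class-sets. -/
def meetClasses {G : Type*} [Group G] (S₁ S₂ : Set (Subgroup G)) : Set (Subgroup G) :=
  {K | K ≠ ⊥ ∧ ∃ A ∈ S₁, ∃ B ∈ S₂, K = A ⊓ B}

/-- The rank of a subgroup of a free group (free by Nielsen–Schreier). -/
noncomputable def subRank {n : ℕ} (H : Subgroup (FreeGroup (Fin n))) : ℕ :=
  Nat.card (IsFreeGroup.Generators H)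

/-- The complexity of a system: the non-increasing sequence of ranks. -/
noncomputable def cx {n k : ℕ} (F : Fin k → Subgroup (FreeGroup (Fin n))) : List ℕ :=
  (List.ofFn fun i => subRank (F i)).insertionSort (· ≥ ·)

/-- Free groups are residually finite: every nontrivial element survives in some finite
permutation group. -/
lemma FreeGroup.exists_perm_hom_ne_one {α : Type*} {w : FreeGroup α} (hw : w ≠ 1) :
    ∃ S : Set (FreeGroup α), S.Finite ∧ ∃ h : FreeGroup α →* Equiv.Perm S, h w ≠ 1 := by
  obtain ⟨L, rfl⟩ : ∃ L, FreeGroup.mk L = w := Quot.exists_rep w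
  set S : Set (FreeGroup α) := {x | x ∈ L.tails.map FreeGroup.mk}
  have mem_S : ∀ s, s <:+ L → FreeGroup.mk s ∈ S := fun s hs =>
    List.mem_map_of_mem ((List.mem_tails _ _).2 hs)
  have hS : S.Finite := List.finite_toSet _
  have := hS.to_subtype
  have hσ : ∀ a : α, ∃ σ : Equiv.Perm S, ∀ x : {x : S // FreeGroup.of a * x ∈ S},
      σ x.1 = ⟨FreeGroup.of a * x.1, x.2⟩ := fun a =>
    Equiv.Perm.exists_extending_pair (fun x : {x : S // FreeGroup.of a * x ∈ S} => x.1)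
      (fun x => ⟨FreeGroup.of a * x.1, x.2⟩) Subtype.val_injective fun x y hxy =>
        Subtype.ext (Subtype.ext (mul_left_cancel (congrArg Subtype.val hxy)))
  choose σ hσ using hσ
  refine ⟨S, hS, FreeGroup.lift σ, fun h1 => hw ?_⟩
  have orbit : ∀ s (hs : s <:+ L), FreeGroup.lift σ (FreeGroup.mk s) ⟨_, mem_S [] L.nil_suffix⟩ =
      ⟨FreeGroup.mk s, mem_S s hs⟩ := by
    intro s
    induction s with
    | nil => intro _; rfl
    | cons p s ih =>
      intro hs
      have hs' := (List.suffix_cons p s).trans hs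
      have ih := ih hs'
      obtain ⟨a, b⟩ := p
      rw [FreeGroup.lift_mk] at ih ⊢
      rw [List.map_cons, List.prod_cons, Equiv.Perm.mul_apply, ih]
      cases b
      · have key : FreeGroup.of a * FreeGroup.mk ((a, false) :: s) = FreeGroup.mk s := by
          rw [FreeGroup.of, FreeGroup.mul_mk]
          exact Quot.sound (FreeGroup.Red.Step.not (L₁ := []) (b := true))
        have := hσ a ⟨⟨_, mem_S _ hs⟩, by rw [key]; exact mem_S s hs'⟩
        rw [cond_false, Equiv.Perm.inv_eq_iff_eq, this]
        exact Subtype.ext key.symm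
      · exact hσ a ⟨⟨_, mem_S s hs'⟩, mem_S _ hs⟩
  have := orbit L List.suffix_rfl
  rw [h1, Equiv.Perm.one_apply] at this
  exact (congrArg Subtype.val this).symm

section FreeGroupRank

variable {G H : Type*} [Group G] [IsFreeGroup G] [Group H] [IsFreeGroup H]

lemma IsFreeGroup.exists_finite_hom_ne_one {g : G} (hg : g ≠ 1) :
    ∃ (S : Set (FreeGroup (IsFreeGroup.Generators G))) (h : G →* Equiv.Perm S),
      S.Finite ∧ h g ≠ 1 := by
  obtain ⟨S, hS, h, hh⟩ := FreeGroup.exists_perm_hom_ne_one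
    (w := IsFreeGroup.toFreeGroup G g) (by simpa using hg)
  exact ⟨S, h.comp (IsFreeGroup.toFreeGroup G).toMonoidHom, hS, hh⟩

lemma IsFreeGroup.lift_symm_comp_injective (K : Type*) [Group K] {f : G →* H}
    (hf : Function.Surjective f) :
    Function.Injective fun u : IsFreeGroup.Generators H → K =>
      IsFreeGroup.lift.symm ((IsFreeGroup.lift u).comp f) := fun _ _ huv =>
  IsFreeGroup.lift.injective
    ((MonoidHom.cancel_right hf).1 (IsFreeGroup.lift.symm.injective huv))

lemma IsFreeGroup.finite_generators_of_surjective {α : Type*} [Finite α]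
    {f : FreeGroup α →* H} (hf : Function.Surjective f) : Finite (IsFreeGroup.Generators H) := by
  have hfun : Finite (IsFreeGroup.Generators H → Multiplicative (ZMod 2)) :=
    Finite.of_injective (fun u => FreeGroup.lift.symm ((IsFreeGroup.lift u).comp f)) fun _ _ huv =>
      IsFreeGroup.lift.injective
        ((MonoidHom.cancel_right hf).1 (FreeGroup.lift.symm.injective huv))
  by_contra hinf
  rw [not_finite_iff_infinite] at hinf
  exact not_finite (IsFreeGroup.Generators H → Multiplicative (ZMod 2))

lemma IsFreeGroup.card_generators_le_of_surjective [Finite (IsFreeGroup.Generators G)]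
    {f : G →* H} (hf : Function.Surjective f) :
    Nat.card (IsFreeGroup.Generators H) ≤ Nat.card (IsFreeGroup.Generators G) := by
  have := IsFreeGroup.finite_generators_of_surjective
    (f := f.comp (IsFreeGroup.mulEquiv G).toMonoidHom)
    (hf.comp (IsFreeGroup.mulEquiv G).surjective)
  have h := Nat.card_le_card_of_injective _
    (IsFreeGroup.lift_symm_comp_injective (Multiplicative (ZMod 2)) hf)
  rw [Nat.card_fun, Nat.card_fun] at h
  have h2 : Nat.card (Multiplicative (ZMod 2)) = 2 := Nat.card_zmod 2
  rw [h2] at h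
  exact (Nat.pow_le_pow_iff_right one_lt_two).1 h

/-- Free groups of finite rank are Hopfian. -/
lemma IsFreeGroup.injective_of_surjective [Finite (IsFreeGroup.Generators G)]
    {f : G →* H} (hf : Function.Surjective f)
    (hcard : Nat.card (IsFreeGroup.Generators H) = Nat.card (IsFreeGroup.Generators G)) :
    Function.Injective f := by
  rw [injective_iff_map_eq_one]
  intro g hg
  by_contra hne
  obtain ⟨S, h, hS, hh⟩ := IsFreeGroup.exists_finite_hom_ne_one hne
  have := hS.to_subtype
  have := IsFreeGroup.finite_generators_of_surjective
    (f := f.comp (IsFreeGroup.mulEquiv G).toMonoidHom)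
    (hf.comp (IsFreeGroup.mulEquiv G).surjective)
  have hbij := (IsFreeGroup.lift_symm_comp_injective (Equiv.Perm S) hf).bijective_of_nat_card_le
    (by rw [Nat.card_fun, Nat.card_fun, hcard])
  obtain ⟨u, hu⟩ := hbij.surjective (IsFreeGroup.lift.symm h)
  apply hh
  rw [← IsFreeGroup.lift.symm.injective hu, MonoidHom.comp_apply, hg, map_one]

end FreeGroupRank

/-- A factor of a free product decomposition is a retract, by a map killing all other factors. -/
lemma IsFreeProductDecomp.exists_retraction {G : Type*} [Group G] {ι : Type*}
    {H : ι → Subgroup G} (h : IsFreeProductDecomp ⊤ H) (i : ι) :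
    ∃ ρ : G →* H i, (∀ x : H i, ρ x = x) ∧ ∀ j ≠ i, ∀ x ∈ H j, ρ x = 1 := by
  classical
  set l := Monoid.CoprodI.lift fun i => (H i).subtype
  have hsurj : Function.Surjective l := by
    rw [← MonoidHom.range_eq_top, Monoid.CoprodI.range_eq_iSup]
    simpa using h.2.2
  set e := MulEquiv.ofBijective l ⟨h.2.1, hsurj⟩
  have he : ∀ j (x : H j), e.symm x = Monoid.CoprodI.of (M := fun i => H i) x := fun j x => by
    rw [MulEquiv.symm_apply_eq]
    exact (Monoid.CoprodI.lift_of (fun i => (H i).subtype) x).symm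
  refine ⟨(Monoid.CoprodI.lift (Pi.mulSingle i (MonoidHom.id (H i)))).comp e.symm.toMonoidHom,
    fun x => ?_, fun j hj x hx => ?_⟩
  · simp [he]
  · have := he j ⟨x, hx⟩
    simp only at this
    simp [this, Pi.mulSingle_eq_of_ne hj]

section FreeFactorSystem

variable {n k : ℕ} {F : Fin k → Subgroup (FreeGroup (Fin n))}

lemma IsFreeFactorSystem.exists_retraction (hF : IsFreeFactorSystem F) (i : Fin k) :
    ∃ ρ : FreeGroup (Fin n) →* F i, (∀ x : F i, ρ x = x) ∧
      ∀ j ≠ i, ∀ x ∈ F j, ρ x = 1 := by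
  obtain ⟨-, B, hB⟩ := hF
  obtain ⟨ρ, h1, h2⟩ := hB.exists_retraction (some i)
  exact ⟨ρ, h1, fun j hj => h2 (some j) (by simpa using hj)⟩

lemma mem_conjSub {G : Type*} [Group G] {c x : G} {A : Subgroup G} :
    x ∈ conjSub c A ↔ ∃ a ∈ A, c * a * c⁻¹ = x := Iff.rfl

lemma conjSub_conjSub {G : Type*} [Group G] (c d : G) (A : Subgroup G) :
    conjSub c (conjSub d A) = conjSub (c * d) A := by
  simp only [conjSub, Subgroup.map_map, map_mul]
  rfl

lemma conjSub_one {G : Type*} [Group G] (A : Subgroup G) : conjSub 1 A = A := by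
  ext x
  simp [mem_conjSub]

lemma mem_classes_self (i : Fin k) : F i ∈ classes F := ⟨i, 1, (conjSub_one _).symm⟩

lemma conjSub_mem_classes {A : Subgroup (FreeGroup (Fin n))} (hA : A ∈ classes F)
    (c : FreeGroup (Fin n)) : conjSub c A ∈ classes F := by
  obtain ⟨i, d, rfl⟩ := hA
  exact ⟨i, c * d, conjSub_conjSub c d _⟩

/-- Distinct members of a free factor system are not conjugate into each other. -/
lemma IsFreeFactorSystem.eq_of_le_conjSub (hF : IsFreeFactorSystem F) {i j : Fin k}
    {c : FreeGroup (Fin n)} (h : F i ≤ conjSub c (F j)) : i = j := by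
  by_contra hij
  obtain ⟨ρ, h1, h2⟩ := hF.exists_retraction i
  refine hF.1 i ((Subgroup.eq_bot_iff_forall _).2 fun x hx => ?_)
  obtain ⟨a, ha, hax⟩ := mem_conjSub.1 (h hx)
  have hρ : ρ x = 1 := by
    rw [← hax, map_mul, map_mul, h2 j (Ne.symm hij) a ha, mul_one, map_inv, mul_inv_cancel]
  exact congrArg Subtype.val ((h1 ⟨x, hx⟩).symm.trans hρ)

lemma IsFreeFactorSystem.finite_generators (hF : IsFreeFactorSystem F) (i : Fin k) :
    Finite (IsFreeGroup.Generators (F i)) := by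
  obtain ⟨ρ, h1, -⟩ := hF.exists_retraction i
  exact IsFreeGroup.finite_generators_of_surjective (f := ρ) fun x => ⟨x, h1 x⟩

variable {m : ℕ} {M : Fin m → Subgroup (FreeGroup (Fin n))}

/-- A member of a free factor system contained in a conjugate of `F j` has rank at most that
of `F j`, with equality only if it is the whole conjugate. -/
lemma IsFreeFactorSystem.subRank_le (hM : IsFreeFactorSystem M) (hF : IsFreeFactorSystem F)
    {i : Fin m} {j : Fin k} {c : FreeGroup (Fin n)} (h : M i ≤ conjSub c (F j)) :
    subRank (M i) ≤ subRank (F j) ∧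
      (subRank (M i) = subRank (F j) → M i = conjSub c (F j)) := by
  obtain ⟨ρ, h1, -⟩ := hM.exists_retraction i
  let f : F j →* M i := (ρ.comp (MulAut.conj c).toMonoidHom).comp (F j).subtype
  have hfa : ∀ a : F j, f a = ρ (c * a * c⁻¹) := fun a => rfl
  have hf : Function.Surjective f := fun x => by
    obtain ⟨a, ha, hax⟩ := mem_conjSub.1 (h x.2)
    exact ⟨⟨a, ha⟩, by rw [hfa, hax, h1]⟩
  have := hF.finite_generators j
  refine ⟨IsFreeGroup.card_generators_le_of_surjective hf, fun hcard => h.antisymm fun y hy => ?_⟩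
  have hinj := IsFreeGroup.injective_of_surjective hf hcard
  obtain ⟨a, ha, rfl⟩ := mem_conjSub.1 hy
  obtain ⟨b, hb, hby⟩ := mem_conjSub.1 (h (f ⟨a, ha⟩).2)
  have hab : (⟨b, hb⟩ : F j) = ⟨a, ha⟩ := hinj (by rw [hfa, hby, h1])
  have hba : b = a := congrArg Subtype.val hab
  rw [← hba, hby]
  exact (f ⟨a, ha⟩).2

end FreeFactorSystem

/-- If the multiplicities of two non-increasing lists agree above `m`, and `m` is strictly more
frequent in the second list, then the first list is lexicographically smaller. -/
lemma List.lex_lt_of_count {α : Type*} [LinearOrder α] (m : α) :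
    ∀ {l₁ l₂ : List α}, l₁.Pairwise (· ≥ ·) → l₂.Pairwise (· ≥ ·) →
      (∀ a, m < a → l₁.count a = l₂.count a) → l₁.count m < l₂.count m →
      List.Lex (· < ·) l₁ l₂
  | _, [], _, _, _, h => by simp at h
  | [], _ :: _, _, _, _, _ => List.Lex.nil
  | x :: l₁, y :: l₂, h₁, h₂, hgt, hm => by
    have hy : ∀ a ∈ y :: l₂, a ≤ y := by
      intro a ha
      rcases List.mem_cons.1 ha with rfl | ha
      · exact le_rfl
      · exact (List.pairwise_cons.1 h₂).1 a ha
    have hmy : m ≤ y := hy m (List.count_pos_iff.1 (by omega))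
    rcases lt_trichotomy x y with hxy | rfl | hxy
    · exact List.Lex.rel hxy
    · refine List.Lex.cons (List.lex_lt_of_count m h₁.of_cons h₂.of_cons (fun a ha => ?_) ?_)
      · have := hgt a ha
        simpa [List.count_cons] using this
      · simpa [List.count_cons] using hm
    · have hx := hgt x (hmy.trans_lt hxy)
      rw [List.count_cons_self] at hx
      exact absurd (hy x (List.count_pos_iff.1 (by omega))) (not_le.2 hxy)

/-- The Dershowitz–Manna order on multisets over a linear order refines to the lexicographic
order on the corresponding non-increasing lists. -/
lemma Multiset.IsDershowitzMannaLT.lex_lt {α : Type*} [LinearOrder α] {l₁ l₂ : List α}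
    (h : Multiset.IsDershowitzMannaLT (l₁ : Multiset α) l₂)
    (h₁ : l₁.Pairwise (· ≥ ·)) (h₂ : l₂.Pairwise (· ≥ ·)) : List.Lex (· < ·) l₁ l₂ := by
  obtain ⟨X, Y, Z, hZ, hX₁, hX₂, hYZ⟩ := h
  obtain ⟨m, hm, hmax⟩ := Z.toFinset.exists_max_image id (by simpa using hZ)
  simp only [Multiset.mem_toFinset, id] at hm hmax
  have hY : ∀ a, m ≤ a → Y.count a = 0 := fun a ha => Multiset.count_eq_zero.2 fun haY => by
    obtain ⟨z, hz, haz⟩ := hYZ a haY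
    exact absurd (hmax z hz) (not_le.2 (ha.trans_lt haz))
  have c₁ : ∀ a, l₁.count a = X.count a + Y.count a := fun a => by
    rw [← Multiset.count_add, ← hX₁, Multiset.coe_count]
  have c₂ : ∀ a, l₂.count a = X.count a + Z.count a := fun a => by
    rw [← Multiset.count_add, ← hX₂, Multiset.coe_count]
  refine List.lex_lt_of_count m h₁ h₂ (fun a ha => ?_) ?_
  · rw [c₁, c₂, hY a ha.le, Multiset.count_eq_zero.2 fun haZ => absurd (hmax a haZ) (not_le.2 ha)]
  · have := Multiset.count_pos.2 hm
    rw [c₁, c₂, hY m le_rfl]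
    omega

/-- If `r` is dominated by `s ∘ φ`, with equality only where the fibre of `φ` is a singleton,
and some index of `s` is not attained with equality, then the multiset of values of `r` is
smaller than that of `s`. -/
lemma Multiset.isDershowitzMannaLT_map_univ {ι κ α : Type*} [Fintype ι] [Fintype κ]
    [PartialOrder α] {r : ι → α} {s : κ → α} (φ : ι → κ) (hle : ∀ i, r i ≤ s (φ i))
    (hfib : ∀ i i', r i = s (φ i) → φ i' = φ i → i' = i)
    (hne : ∃ j, ∀ i, r i = s (φ i) → φ i ≠ j) :
    Multiset.IsDershowitzMannaLT (Finset.univ.val.map r) (Finset.univ.val.map s) := by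
  classical
  set E : Finset ι := {i | r i = s (φ i)}
  have hE : ∀ i, i ∈ E ↔ r i = s (φ i) := fun i => by simp [E]
  have hinj : Set.InjOn φ E := fun i _ i' hi' h => hfib i' i ((hE _).1 hi') h
  obtain ⟨j, hj⟩ := hne
  refine ⟨E.val.map r, Eᶜ.val.map r, (E.image φ)ᶜ.val.map s, ?_, ?_, ?_, ?_⟩
  · have hjmem : j ∈ (E.image φ)ᶜ := by
      simp only [Finset.mem_compl, Finset.mem_image, not_exists, not_and]
      exact fun i hi => hj i ((hE i).1 hi)
    intro h0
    have hs := Multiset.mem_map_of_mem (s := (E.image φ)ᶜ.val) s hjmem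
    rw [h0] at hs
    exact Multiset.notMem_zero _ hs
  · rw [← Multiset.map_add, ← Finset.disjUnion_val _ _ disjoint_compl_right,
      Finset.disjUnion_eq_union, Finset.union_compl]
  · have : E.val.map r = (E.image φ).val.map s := by
      rw [Finset.image_val_of_injOn hinj, Multiset.map_map]
      exact Multiset.map_congr rfl fun i hi => (hE i).1 hi
    rw [this, ← Multiset.map_add, ← Finset.disjUnion_val _ _ disjoint_compl_right,
      Finset.disjUnion_eq_union, Finset.union_compl]
  · intro y hy
    obtain ⟨i, hi, rfl⟩ := Multiset.mem_map.1 hy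
    have hiE : i ∉ E := Finset.mem_compl.1 hi
    refine ⟨s (φ i), Multiset.mem_map_of_mem s (Finset.mem_compl.2 fun hφ => ?_),
      (hle i).lt_of_ne fun h => hiE ((hE i).2 h)⟩
    obtain ⟨e, he, hei⟩ := Finset.mem_image.1 hφ
    exact hiE (hfib e i ((hE e).1 he) hei.symm ▸ he)

lemma coe_cx {n k : ℕ} (F : Fin k → Subgroup (FreeGroup (Fin n))) :
    (cx F : Multiset ℕ) = Finset.univ.val.map fun i => subRank (F i) := by
  rw [cx, Multiset.coe_eq_coe.2 (List.perm_insertionSort _ _), Fin.univ_val_map]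

lemma pairwise_cx {n k : ℕ} (F : Fin k → Subgroup (FreeGroup (Fin n))) :
    (cx F).Pairwise (· ≥ ·) :=
  List.pairwise_insertionSort _ _

/-- Lemma 2.6.3: if `F₁ ∧ F₂ ≠ F₁` then the complexity of `F₁ ∧ F₂` is strictly smaller
than the complexity of `F₁`, complexities being compared lexicographically as
non-increasing sequences of ranks (the empty system having complexity `0`, i.e. the
empty sequence). -/
theorem stmt4 (n k₁ k₂ kM : ℕ)
    (F₁ : Fin k₁ → Subgroup (FreeGroup (Fin n)))
    (F₂ : Fin k₂ → Subgroup (FreeGroup (Fin n)))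
    (M : Fin kM → Subgroup (FreeGroup (Fin n)))
    (hF₁ : IsFreeFactorSystem F₁) (hF₂ : IsFreeFactorSystem F₂)
    (hM : IsFreeFactorSystem M)
    (hmeet : classes M = meetClasses (classes F₁) (classes F₂))
    (hne : classes M ≠ classes F₁) :
    List.Lex (· < ·) (cx M) (cx F₁) := by
  have hA : ∀ i, ∃ (j : Fin k₁) (c : FreeGroup (Fin n)), M i ≤ conjSub c (F₁ j) := fun i => by
    have hi : M i ∈ meetClasses (classes F₁) (classes F₂) := hmeet ▸ mem_classes_self i
    obtain ⟨-, A, ⟨j, c, rfl⟩, B, -, hAB⟩ := hi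
    exact ⟨j, c, hAB ▸ inf_le_left⟩
  choose φ c hφ using hA
  have hrank := fun i => hM.subRank_le hF₁ (hφ i)
  have hfib : ∀ i i', subRank (M i) = subRank (F₁ (φ i)) → φ i' = φ i → i' = i := by
    intro i i' hi h
    refine hM.eq_of_le_conjSub (c := c i' * (c i)⁻¹) ((hφ i').trans (le_of_eq ?_))
    rw [(hrank i).2 hi, conjSub_conjSub, inv_mul_cancel_right, h]
  have hex : ∃ j, ∀ i, subRank (M i) = subRank (F₁ (φ i)) → φ i ≠ j := by
    by_contra! hall
    refine hne (Set.Subset.antisymm ?_ ?_)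
    · rintro _ ⟨i, d, rfl⟩
      obtain ⟨e, he, hei⟩ := hall (φ i)
      obtain rfl := hfib e i he hei.symm
      exact conjSub_mem_classes ⟨_, _, (hrank i).2 he⟩ d
    · rintro _ ⟨j, d, rfl⟩
      obtain ⟨i, hi, rfl⟩ := hall j
      refine ⟨i, d * (c i)⁻¹, ?_⟩
      rw [(hrank i).2 hi, conjSub_conjSub, inv_mul_cancel_right]
  have hlt := Multiset.isDershowitzMannaLT_map_univ (r := fun i => subRank (M i))
    (s := fun j => subRank (F₁ j)) φ (fun i => (hrank i).1) hfib hex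
  rw [← coe_cx, ← coe_cx] at hlt
  exact hlt.lex_lt (pairwise_cx M) (pairwise_cx F₁)
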